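/- arXiv:2103.04215 — 7 statements merged into one kernel-verified Lean document; each statement's English description precedes it below -/
import Mathlib

section
/- Let v = (v_1, …, v_N) ∈ [0,1]^N satisfy 0 ≤ v_1 ≤ v_2 ≤ … ≤ v_N ≤ 1/2. Then v_n ≤ 1/m(v) for every index n with 1 ≤ n ≤ ⌈m(v)⌉. -/
/-- For `v : Fin N → ℝ` and `s : ℝ`, the index set
`I_s(v) = { n : min (v n) (1 - v n) < 1/s }`. -/
noncomputable def Ival {N : ℕ} (v : Fin N → ℝ) (s : ℝ) : Finset (Fin N) :=
  Finset.univ.filter (fun n => min (v n) (1 - v n) < 1 / s)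

/-- `m(v) = min { s > 0 : s ≥ |I_s(v)| }` (the minimum exists; we use `sInf`). -/
noncomputable def mVal {N : ℕ} (v : Fin N → ℝ) : ℝ :=
  sInf {s : ℝ | 0 < s ∧ ((Ival v s).card : ℝ) ≤ s}

/-- if `0 ≤ v_1 ≤ … ≤ v_N ≤ 1/2`, then `v n ≤ 1/m(v)` for every
index `n` with `1 ≤ n ≤ ⌈m(v)⌉` (here `n : Fin N` is 0-indexed, so the
condition reads `(n : ℕ) + 1 ≤ ⌈m(v)⌉`). -/
theorem stmt1 {N : ℕ} (v : Fin N → ℝ)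
    (h0 : ∀ n, 0 ≤ v n) (hmono : Monotone v) (hhalf : ∀ n, v n ≤ 1 / 2)
    (n : Fin N) (hn : ((n : ℕ) : ℤ) + 1 ≤ ⌈mVal v⌉) :
    v n ≤ 1 / mVal v := by
  have hnm : (n : ℝ) < mVal v := by
    have h : ((n : ℕ) : ℤ) < ⌈mVal v⌉ := by omega
    exact_mod_cast Int.lt_ceil.mp h
  have hm : 0 < mVal v := lt_of_le_of_lt (Nat.cast_nonneg _) hnm
  by_contra! hlt
  have hv : 0 < v n := lt_trans (by positivity) hlt
  obtain ⟨s, hs, hsm⟩ := exists_between (max_lt hnm ((one_div_lt hm hv).mp hlt))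
  obtain ⟨hns, hvs⟩ := max_lt_iff.mp hs
  have hs0 : 0 < s := lt_trans (by positivity) hvs
  have hsub : Ival v s ⊆ Finset.Iio n := by
    intro k hk
    simp only [Ival, Finset.mem_filter, Finset.mem_univ, true_and] at hk
    rw [min_eq_left (by linarith [hhalf k])] at hk
    rw [Finset.mem_Iio]
    by_contra! hnk
    exact (hk.trans ((one_div_lt hv hs0).mp hvs)).not_ge (hmono hnk)
  have hcard : (Ival v s).card ≤ (n : ℕ) := by
    simpa using Finset.card_le_card hsub
  have hle : mVal v ≤ s :=
    csInf_le ⟨0, fun _ ht => ht.1.le⟩ ⟨hs0, (Nat.cast_le.mpr hcard).trans hns.le⟩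
  exact hle.not_gt hsm
end

section
/- Consider the Bernoulli hierarchical causal bandit joint distribution P with parameters α ∈ (0,1), p, q ∈ (0,1)^N, and r : {0,1}^N → [0,1]. For every i ∈ {1,…,N}, x ∈ {0,1}, and s ∈ {0,1}, the following three quantities coincide: the observational conditional probability P(Y = 1 | X_i = x, S = s); the conditional probability P(Y = 1 | S = s) computed under the interventional distribution P(· | do(X_i = x)); and the conditional probability P(Y = 1 | X_i = x) computed under the interventional distribution P(· | do(S = s)). -/
open Finset

/-- Conditional arm probability `θ_j(s)`: `p_j` if `s = 1`, `q_j` if `s = 0`. -/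
noncomputable def theta {N : ℕ} (p q : Fin N → ℝ) (s : Bool) (j : Fin N) : ℝ :=
  if s then p j else q j

/-- The factor contributed by arm `j`: `θ_j(s)^{x_j} (1 - θ_j(s))^{1 - x_j}`. -/
noncomputable def armF {N : ℕ} (p q : Fin N → ℝ) (s : Bool) (x : Fin N → Bool)
    (j : Fin N) : ℝ :=
  if x j then theta p q s j else 1 - theta p q s j

/-- The Bernoulli HCB joint (observational) mass function. -/
noncomputable def jointP {N : ℕ} (α : ℝ) (p q : Fin N → ℝ)
    (r : (Fin N → Bool) → ℝ) (s : Bool) (x : Fin N → Bool) (y : Bool) : ℝ :=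
  (if s then α else 1 - α) * (∏ j, armF p q s x j) * (if y then r x else 1 - r x)

/-- Interventional mass function under `do(X_i = x*)`: the factor of arm `i`
is replaced by the indicator `1{x_i = x*}`. -/
noncomputable def doXP {N : ℕ} (α : ℝ) (p q : Fin N → ℝ)
    (r : (Fin N → Bool) → ℝ) (i : Fin N) (xstar : Bool)
    (s : Bool) (x : Fin N → Bool) (y : Bool) : ℝ :=
  (if s then α else 1 - α) *
    (∏ j, if j = i then (if x j = xstar then (1 : ℝ) else 0) else armF p q s x j) *
    (if y then r x else 1 - r x)

/-- Interventional mass function under `do(S = s*)`: the context factor is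
replaced by the indicator `1{s = s*}`. -/
noncomputable def doSP {N : ℕ} (α : ℝ) (p q : Fin N → ℝ)
    (r : (Fin N → Bool) → ℝ) (sstar : Bool)
    (s : Bool) (x : Fin N → Bool) (y : Bool) : ℝ :=
  (if s = sstar then (1 : ℝ) else 0) * (∏ j, armF p q s x j) *
    (if y then r x else 1 - r x)

/-- Observational conditional probability `P(Y = 1 | X_i = xv, S = s)`. -/
noncomputable def condYgivenXS {N : ℕ} (α : ℝ) (p q : Fin N → ℝ)
    (r : (Fin N → Bool) → ℝ) (i : Fin N) (xv : Bool) (s : Bool) : ℝ :=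
  (∑ x ∈ univ.filter (fun x : Fin N → Bool => x i = xv), jointP α p q r s x true) /
  (∑ x ∈ univ.filter (fun x : Fin N → Bool => x i = xv), ∑ y : Bool, jointP α p q r s x y)

/-- `P(Y = 1 | S = s)` computed under the interventional distribution
`P(· | do(X_i = xv))`. -/
noncomputable def condYgivenS_doX {N : ℕ} (α : ℝ) (p q : Fin N → ℝ)
    (r : (Fin N → Bool) → ℝ) (i : Fin N) (xv : Bool) (s : Bool) : ℝ :=
  (∑ x : Fin N → Bool, doXP α p q r i xv s x true) /
  (∑ x : Fin N → Bool, ∑ y : Bool, doXP α p q r i xv s x y)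

/-- `P(Y = 1 | X_i = xv)` computed under the interventional distribution
`P(· | do(S = s))`. -/
noncomputable def condYgivenX_doS {N : ℕ} (α : ℝ) (p q : Fin N → ℝ)
    (r : (Fin N → Bool) → ℝ) (i : Fin N) (xv : Bool) (s : Bool) : ℝ :=
  (∑ s' : Bool, ∑ x ∈ univ.filter (fun x : Fin N → Bool => x i = xv),
      doSP α p q r s s' x true) /
  (∑ s' : Bool, ∑ x ∈ univ.filter (fun x : Fin N → Bool => x i = xv),
      ∑ y : Bool, doSP α p q r s s' x y)

/-- Conditioning on `X_i = xv` multiplies the `do(X_i = xv)` mass by the factor of arm `i`. -/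
theorem ite_jointP_eq_mul_doXP {N : ℕ} (α : ℝ) (p q : Fin N → ℝ)
    (r : (Fin N → Bool) → ℝ) (i : Fin N) (xv s : Bool) (x : Fin N → Bool) (y : Bool) :
    (if x i = xv then jointP α p q r s x y else 0) =
      (if xv then theta p q s i else 1 - theta p q s i) * doXP α p q r i xv s x y := by
  have hprod : ∏ j ∈ univ.erase i,
      (if j = i then (if x j = xv then (1 : ℝ) else 0) else armF p q s x j) =
      ∏ j ∈ univ.erase i, armF p q s x j :=
    prod_congr rfl fun j hj => if_neg (ne_of_mem_erase hj)
  unfold jointP doXP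
  rw [← mul_prod_erase univ _ (mem_univ i), ← mul_prod_erase univ _ (mem_univ i), hprod,
    if_pos rfl]
  split_ifs with h <;> simp_all [armF] <;> ring

/-- The observational mass is the `do(S = s)` mass times the prior probability of `s`. -/
theorem jointP_eq_mul_doSP {N : ℕ} (α : ℝ) (p q : Fin N → ℝ)
    (r : (Fin N → Bool) → ℝ) (s : Bool) (x : Fin N → Bool) (y : Bool) :
    jointP α p q r s x y = (if s then α else 1 - α) * doSP α p q r s s x y := by
  simp only [jointP, doSP, if_true]
  ring

theorem doSP_of_ne {N : ℕ} (α : ℝ) (p q : Fin N → ℝ) (r : (Fin N → Bool) → ℝ)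
    {s s' : Bool} (h : s' ≠ s) (x : Fin N → Bool) (y : Bool) :
    doSP α p q r s s' x y = 0 := by
  simp [doSP, h]

theorem condYgivenXS_eq_condYgivenS_doX {N : ℕ} (α : ℝ) (p q : Fin N → ℝ)
    (hp : ∀ j, p j ∈ Set.Ioo (0 : ℝ) 1) (hq : ∀ j, q j ∈ Set.Ioo (0 : ℝ) 1)
    (r : (Fin N → Bool) → ℝ) (i : Fin N) (xv s : Bool) :
    condYgivenXS α p q r i xv s = condYgivenS_doX α p q r i xv s := by
  have hθ : theta p q s i ∈ Set.Ioo (0 : ℝ) 1 := by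
    unfold theta
    split_ifs
    exacts [hp i, hq i]
  have hc : (if xv then theta p q s i else 1 - theta p q s i) ≠ 0 := by
    split_ifs
    exacts [hθ.1.ne', (sub_pos.2 hθ.2).ne']
  unfold condYgivenXS condYgivenS_doX
  rw [sum_comm, sum_comm (s := univ (α := Fin N → Bool))]
  simp only [sum_filter, ite_jointP_eq_mul_doXP, ← mul_sum]
  exact mul_div_mul_left _ _ hc

theorem condYgivenXS_eq_condYgivenX_doS {N : ℕ} (α : ℝ) (hα : α ∈ Set.Ioo (0 : ℝ) 1)
    (p q : Fin N → ℝ) (r : (Fin N → Bool) → ℝ) (i : Fin N) (xv s : Bool) :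
    condYgivenXS α p q r i xv s = condYgivenX_doS α p q r i xv s := by
  have hc : (if s then α else 1 - α) ≠ 0 := by
    split_ifs
    exacts [hα.1.ne', (sub_pos.2 hα.2).ne']
  unfold condYgivenXS condYgivenX_doS
  rw [Fintype.sum_eq_single s fun s' h => by simp only [doSP_of_ne α p q r h, sum_const_zero],
    Fintype.sum_eq_single s fun s' h => by simp only [doSP_of_ne α p q r h, sum_const_zero]]
  simp only [jointP_eq_mul_doSP, ← mul_sum]
  exact mul_div_mul_left _ _ hc

/-- in the Bernoulli HCB, for every `i`, `x`, `s`, the three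
quantities `P(Y=1 | X_i=x, S=s)`, `P(Y=1 | S=s)` under `do(X_i=x)`, and
`P(Y=1 | X_i=x)` under `do(S=s)` coincide. -/
theorem stmt5 {N : ℕ} (α : ℝ) (hα : α ∈ Set.Ioo (0 : ℝ) 1)
    (p q : Fin N → ℝ) (hp : ∀ j, p j ∈ Set.Ioo (0 : ℝ) 1)
    (hq : ∀ j, q j ∈ Set.Ioo (0 : ℝ) 1)
    (r : (Fin N → Bool) → ℝ) (hr : ∀ x, r x ∈ Set.Icc (0 : ℝ) 1)
    (i : Fin N) (xv : Bool) (s : Bool) :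
    condYgivenXS α p q r i xv s = condYgivenS_doX α p q r i xv s ∧
    condYgivenS_doX α p q r i xv s = condYgivenX_doS α p q r i xv s := by
  have h := condYgivenXS_eq_condYgivenS_doX α p q hp hq r i xv s
  exact ⟨h, h.symm.trans (condYgivenXS_eq_condYgivenX_doS α hα p q r i xv s)⟩
end

section
/- Let P and Q be probability measures on the same measurable space with finite Kullback–Leibler divergence D_KL(P, Q). Then for every measurable set B, P(B) + Q(Bᶜ) ≥ (1/2) · exp( − D_KL(P, Q) ), where Bᶜ denotes the complement of B. -/
open MeasureTheory

/-- A linear lower bound for `2 * m * exp (-L / 2)` with `m = exp (-D / 2)`, combined with the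
arithmetic-geometric mean inequality at weight `c`. -/
lemma exp_neg_mul_two_sub_le (D L c : ℝ) (hc : 0 < c) :
    Real.exp (-D) * (2 - (L - D)) ≤ c + Real.exp (-D) / c * Real.exp (-L) := by
  have hD : Real.exp (-D) = Real.exp (-D / 2) ^ 2 := by
    rw [← Real.exp_nat_mul]; congr 1; push_cast; ring
  have hL : Real.exp (-L) = Real.exp (-L / 2) ^ 2 := by
    rw [← Real.exp_nat_mul]; congr 1; push_cast; ring
  have hLD : Real.exp (-L / 2) = Real.exp (-D / 2) * Real.exp (-(L - D) / 2) := by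
    rw [← Real.exp_add]; congr 1; ring
  have htangent : Real.exp (-D / 2) * (1 - (L - D) / 2) ≤ Real.exp (-L / 2) := by
    rw [hLD]
    gcongr
    linarith [Real.add_one_le_exp (-(L - D) / 2)]
  rw [hD, hL]
  set m := Real.exp (-D / 2)
  set y := Real.exp (-L / 2)
  have hm : 0 < m := Real.exp_pos _
  have hamgm : 2 * (m * y) ≤ c + m ^ 2 / c * y ^ 2 := by
    have h : c + m ^ 2 / c * y ^ 2 - 2 * (m * y) = (c - m * y) ^ 2 / c := by
      field_simp
      ring
    have : 0 ≤ (c - m * y) ^ 2 / c := by positivity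
    linarith
  nlinarith [mul_le_mul_of_nonneg_left htangent hm.le]

/-- if `P ≪ Q` are probability measures with finite KL divergence
`D_KL(P, Q) = ∫ log (dP/dQ) dP` (finiteness expressed via integrability of the
log Radon–Nikodym derivative), then for every measurable set `B`,
`P(B) + Q(Bᶜ) ≥ (1/2) exp(- D_KL(P, Q))`. -/
theorem stmt8 {Ω : Type*} [MeasurableSpace Ω] (P Q : Measure Ω)
    [IsProbabilityMeasure P] [IsProbabilityMeasure Q] (hac : P ≪ Q)
    (hint : Integrable (fun ω => Real.log (P.rnDeriv Q ω).toReal) P)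
    (B : Set Ω) (hB : MeasurableSet B) :
    (1 / 2) * Real.exp (-(∫ ω, Real.log (P.rnDeriv Q ω).toReal ∂P)) ≤
      (P B).toReal + (Q Bᶜ).toReal := by
  change Integrable (llr P Q) P at hint
  change 1 / 2 * Real.exp (-(∫ ω, llr P Q ω ∂P)) ≤ P.real B + Q.real Bᶜ
  set D := ∫ ω, llr P Q ω ∂P with hD
  set E := Real.exp (-D)
  have hE0 : 0 < E := Real.exp_pos _
  set r : Ω → ℝ := fun ω => (Q.rnDeriv P ω).toReal
  have hr : Integrable r P := Measure.integrable_toReal_rnDeriv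
  have hf : Integrable (fun ω => E * (2 - (llr P Q ω - D))) P := by fun_prop
  have htotal : ∫ ω, E * (2 - (llr P Q ω - D)) ∂P = 2 * E := by
    rw [integral_const_mul, integral_sub (by fun_prop) (by fun_prop),
      integral_sub hint (by fun_prop), ← hD]
    simp [mul_comm]
  have hset (s : Set Ω) (c : ℝ) (hc : 0 < c) :
      ∫ ω in s, E * (2 - (llr P Q ω - D)) ∂P ≤ c * P.real s + E / c * Q.real s := by
    calc ∫ ω in s, E * (2 - (llr P Q ω - D)) ∂P
        ≤ ∫ ω in s, (c + E / c * r ω) ∂P := by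
          refine integral_mono_ae hf.integrableOn
            (((integrable_const c).add (hr.const_mul _)).integrableOn) ?_
          filter_upwards [ae_restrict_of_ae (exp_neg_llr hac)] with ω hω
          have h := exp_neg_mul_two_sub_le D (llr P Q ω) c hc
          rwa [show Real.exp (-llr P Q ω) = r ω from hω] at h
      _ = c * P.real s + E / c * ∫ ω in s, r ω ∂P := by
          rw [integral_add (integrable_const c) (hr.const_mul _).integrableOn,
            integral_const_mul]
          simp [mul_comm]
      _ ≤ c * P.real s + E / c * Q.real s := by
          gcongr
          exact Measure.setIntegral_toReal_rnDeriv_le (measure_ne_top Q s)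
  have hsplit := integral_add_compl hB hf
  have h₁ := hset B 2 two_pos
  have h₂ := hset Bᶜ (E / 2) (by positivity)
  rw [show E / (E / 2) = 2 by field_simp] at h₂
  have hQ : E / 2 * Q.real B ≤ E / 2 * 1 := by gcongr; exact measureReal_le_one
  have hP : E / 2 * P.real Bᶜ ≤ E / 2 * 1 := by gcongr; exact measureReal_le_one
  linarith
end

section
/- Fix α ∈ (0,1) and p, q ∈ (0,1)^N with p_1 ≤ p_2 ≤ … ≤ p_N ≤ 1/2 and m(p) > 2, and let M = ⌈m(p)⌉ (note M ≤ N). Then for every i ∈ {1,…,M}: α · (1 − 1/m(p))^{M−1} ≤ α · ∏_{ℓ ∈ {1,…,M} \ {i}} (1 − p_ℓ) + (1 − α) · ∏_{ℓ ∈ {1,…,M} \ {i}} (1 − q_ℓ) ≤ 1. (The middle quantity equals the probability, in the Bernoulli HCB with these parameters, that under the intervention do(X_i = 1) the arm vector X lies in the set 𝒳_i* = { x ∈ {0,1}^N : x_i = 1 and x_ℓ = 0 for all ℓ ∈ {1,…,M} \ {i} }.) -/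
open Finset

theorem mVal_le {N : ℕ} {v : Fin N → ℝ} {s : ℝ} (hs : 0 < s)
    (h : ((Ival v s).card : ℝ) ≤ s) : mVal v ≤ s :=
  csInf_le ⟨0, fun _ ht => ht.1.le⟩ ⟨hs, h⟩

theorem mVal_le_length {N : ℕ} (hN : 0 < N) (v : Fin N → ℝ) : mVal v ≤ N :=
  mVal_le (by exact_mod_cast hN) (by exact_mod_cast (card_le_univ _).trans_eq (Fintype.card_fin N))

/-- The entries of a sorted vector with index below `⌈m(v)⌉` are at most `1 / m(v)`. -/
theorem le_one_div_mVal {N : ℕ} {v : Fin N → ℝ} (hv : ∀ j, 0 < v j) (hmono : Monotone v)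
    (hhalf : ∀ j, v j ≤ 1 / 2) (hm : 0 < mVal v) (l : Fin N) (hl : (l : ℝ) < mVal v) :
    v l ≤ 1 / mVal v := by
  by_contra! hlt
  have hpos : 0 < 1 / v l := one_div_pos.2 (hv l)
  have hs : max (1 / v l) (l : ℝ) < mVal v := max_lt ((one_div_lt hm (hv l)).1 hlt) hl
  refine hs.not_ge (mVal_le (lt_max_of_lt_left hpos) ?_)
  have hsub : Ival v (max (1 / v l) (l : ℝ)) ⊆ Iio l := by
    intro n hn
    rw [Ival, mem_filter, min_eq_left (by linarith [hhalf n])] at hn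
    rw [mem_Iio]
    refine hmono.reflect_lt (hn.2.trans_le ?_)
    exact (one_div_le_one_div_of_le hpos (le_max_left _ _)).trans_eq (one_div_one_div _)
  have hcard := card_le_card hsub
  rw [Fin.card_Iio] at hcard
  exact le_max_of_le_right (by exact_mod_cast hcard)

theorem card_filter_lt_ne_le {N : ℕ} (M : ℕ) (i : Fin N) (hi : (i : ℕ) < M) :
    (univ.filter (fun l : Fin N => (l : ℕ) < M ∧ l ≠ i)).card ≤ M - 1 := by
  calc _ ≤ ((range M).erase (i : ℕ)).card := by
        refine card_le_card_of_injOn (fun l : Fin N => (l : ℕ)) ?_ Fin.val_injective.injOn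
        intro l hl
        simpa [Fin.ext_iff, and_comm] using hl
    _ = M - 1 := by rw [card_erase_of_mem (mem_range.2 hi), card_range]

/-- for sorted `p` with `p_N ≤ 1/2` and `m(p) > 2`, with
`M = ⌈m(p)⌉` (and `M ≤ N`), for every index `i` among the first `M` indices,
`α (1 - 1/m(p))^{M-1} ≤ α ∏_{ℓ < M, ℓ ≠ i} (1 - p_ℓ) + (1-α) ∏_{ℓ < M, ℓ ≠ i} (1 - q_ℓ) ≤ 1`.
(Indices are 0-based: `ℓ ∈ {1,…,M}` becomes `(ℓ : ℕ) < M`.) -/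
theorem stmt10 {N : ℕ} (α : ℝ) (hα : α ∈ Set.Ioo (0 : ℝ) 1)
    (p q : Fin N → ℝ) (hp : ∀ j, p j ∈ Set.Ioo (0 : ℝ) 1)
    (hq : ∀ j, q j ∈ Set.Ioo (0 : ℝ) 1)
    (hmono : Monotone p) (hhalf : ∀ j, p j ≤ 1 / 2) (hm : 2 < mVal p)
    (M : ℕ) (hM : (M : ℤ) = ⌈mVal p⌉) (i : Fin N) (hi : (i : ℕ) < M) :
    M ≤ N ∧
    α * (1 - 1 / mVal p) ^ (M - 1) ≤
      α * ∏ ℓ ∈ univ.filter (fun ℓ : Fin N => (ℓ : ℕ) < M ∧ ℓ ≠ i), (1 - p ℓ) +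
        (1 - α) * ∏ ℓ ∈ univ.filter (fun ℓ : Fin N => (ℓ : ℕ) < M ∧ ℓ ≠ i), (1 - q ℓ) ∧
    α * ∏ ℓ ∈ univ.filter (fun ℓ : Fin N => (ℓ : ℕ) < M ∧ ℓ ≠ i), (1 - p ℓ) +
        (1 - α) * ∏ ℓ ∈ univ.filter (fun ℓ : Fin N => (ℓ : ℕ) < M ∧ ℓ ≠ i), (1 - q ℓ) ≤ 1 := by
  have hm0 : 0 < mVal p := by linarith
  have hMN : M ≤ N := by
    have h : ⌈mVal p⌉ ≤ (N : ℤ) := Int.ceil_le.2 (by exact_mod_cast mVal_le_length i.pos p)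
    omega
  have hinv : 1 / mVal p ≤ 1 := (div_le_one hm0).2 (by linarith)
  have hinv0 : 0 < 1 / mVal p := one_div_pos.2 hm0
  set S := univ.filter (fun ℓ : Fin N => (ℓ : ℕ) < M ∧ ℓ ≠ i)
  have hP : (1 - 1 / mVal p) ^ (M - 1) ≤ ∏ ℓ ∈ S, (1 - p ℓ) := by
    calc (1 - 1 / mVal p) ^ (M - 1) ≤ (1 - 1 / mVal p) ^ S.card :=
          pow_le_pow_of_le_one (by linarith) (by linarith) (card_filter_lt_ne_le M i hi)
      _ = ∏ _ℓ ∈ S, (1 - 1 / mVal p) := (prod_const _).symm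
      _ ≤ ∏ ℓ ∈ S, (1 - p ℓ) := by
          refine prod_le_prod (fun _ _ => by linarith) fun ℓ hℓ => ?_
          have hℓM : ((ℓ : ℕ) : ℤ) < ⌈mVal p⌉ := by
            rw [← hM]
            exact_mod_cast (mem_filter.1 hℓ).2.1
          have hlt : (ℓ : ℝ) < mVal p := by exact_mod_cast Int.lt_ceil.1 hℓM
          linarith [le_one_div_mVal (fun j => (hp j).1) hmono hhalf hm0 ℓ hlt]
  have hP1 : ∏ ℓ ∈ S, (1 - p ℓ) ≤ 1 :=
    prod_le_one (fun ℓ _ => by linarith [(hp ℓ).2]) fun ℓ _ => by linarith [(hp ℓ).1]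
  have hQ0 : 0 ≤ ∏ ℓ ∈ S, (1 - q ℓ) := prod_nonneg fun ℓ _ => by linarith [(hq ℓ).2]
  have hQ1 : ∏ ℓ ∈ S, (1 - q ℓ) ≤ 1 :=
    prod_le_one (fun ℓ _ => by linarith [(hq ℓ).2]) fun ℓ _ => by linarith [(hq ℓ).1]
  obtain ⟨hα0, hα1⟩ := hα
  have hβ0 : 0 ≤ 1 - α := by linarith
  refine ⟨hMN, ?_, ?_⟩
  · linarith [mul_le_mul_of_nonneg_left hP hα0.le, mul_nonneg hβ0 hQ0]
  · linarith [mul_le_mul_of_nonneg_left hP1 hα0.le, mul_le_mul_of_nonneg_left hQ1 hβ0]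
end

section
/- Fix p, q ∈ (0,1)^N with m(p) > 2, and let M = ⌈m(p)⌉ and k = ⌈m(p)⌉ − ⌊m(p)/2⌋. Let i ∈ {1,…,M} be an index such that there are at least k indices ℓ ∈ {1,…,M} \ {i} with q_ℓ ≥ q_i. Then q_i · ∏_{ℓ ∈ {1,…,M} \ {i}} (1 − q_ℓ) ≤ 1/m(p). (This quantity is the probability, in the Bernoulli HCB, that under the intervention do(S = 0) the arm vector X lies in the set 𝒳_i* = { x ∈ {0,1}^N : x_i = 1 and x_ℓ = 0 for all ℓ ∈ {1,…,M} \ {i} }.) -/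
open Finset

theorem two_mul_mul_one_sub_pow_le_one {x : ℝ} (hx0 : 0 ≤ x) (hx1 : x ≤ 1) (k : ℕ) :
    2 * k * (x * (1 - x) ^ k) ≤ 1 := by
  have ht : 0 ≤ (k : ℝ) * x := by positivity
  have hpow : (1 - x) ^ k ≤ Real.exp (-(k * x)) := by
    calc (1 - x) ^ k ≤ Real.exp (-x) ^ k :=
          pow_le_pow_left₀ (by linarith) (Real.one_sub_le_exp_neg x) k
      _ = Real.exp (-(k * x)) := by rw [← Real.exp_nat_mul]; congr 1; ring
  have hexp : 2 * (k * x) ≤ Real.exp (k * x) := by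
    have := Real.quadratic_le_exp_of_nonneg ht
    nlinarith [sq_nonneg ((k : ℝ) * x - 1)]
  calc 2 * k * (x * (1 - x) ^ k) = 2 * (k * x) * (1 - x) ^ k := by ring
    _ ≤ Real.exp (k * x) * Real.exp (-(k * x)) :=
        mul_le_mul hexp hpow (pow_nonneg (by linarith) k) (Real.exp_pos _).le
    _ = 1 := by rw [← Real.exp_add, add_neg_cancel, Real.exp_zero]

theorem prod_one_sub_le_pow {ι : Type*} {s t : Finset ι} {f : ι → ℝ} {a : ℝ} {k : ℕ}
    (hts : t ⊆ s) (hf0 : ∀ j ∈ s, 0 ≤ f j) (hf1 : ∀ j ∈ s, f j ≤ 1)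
    (hat : ∀ j ∈ t, a ≤ f j) (hk : k ≤ t.card) :
    ∏ j ∈ s, (1 - f j) ≤ (1 - a) ^ k := by
  obtain ⟨u, hut, rfl⟩ := Finset.exists_subset_card_eq hk
  have hus := hut.trans hts
  calc ∏ j ∈ s, (1 - f j) ≤ ∏ j ∈ u, (1 - f j) :=
        Finset.prod_le_prod_of_subset_of_le_one hus
          (fun j hj => sub_nonneg.2 (hf1 j hj)) (fun j hj _ => by linarith [hf0 j hj])
    _ ≤ ∏ _j ∈ u, (1 - a) :=
        Finset.prod_le_prod (fun j hj => sub_nonneg.2 (hf1 j (hus hj)))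
          (fun j hj => by linarith [hat j (hut hj)])
    _ = (1 - a) ^ u.card := Finset.prod_const _

/-- with `M = ⌈m(p)⌉`, `k = ⌈m(p)⌉ - ⌊m(p)/2⌋`, and an index `i`
among the first `M` indices such that at least `k` indices `ℓ < M`, `ℓ ≠ i`
satisfy `q_ℓ ≥ q_i`, one has `q_i ∏_{ℓ < M, ℓ ≠ i} (1 - q_ℓ) ≤ 1/m(p)`.
(Indices are 0-based: `ℓ ∈ {1,…,M}` becomes `(ℓ : ℕ) < M`.) -/
theorem stmt11 {N : ℕ} (p q : Fin N → ℝ)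
    (hp : ∀ j, p j ∈ Set.Ioo (0 : ℝ) 1) (hq : ∀ j, q j ∈ Set.Ioo (0 : ℝ) 1)
    (hm : 2 < mVal p)
    (M : ℕ) (hM : (M : ℤ) = ⌈mVal p⌉)
    (k : ℕ) (hk : (k : ℤ) = ⌈mVal p⌉ - ⌊mVal p / 2⌋)
    (i : Fin N) (hi : (i : ℕ) < M)
    (hcard : k ≤ (univ.filter
      (fun ℓ : Fin N => (ℓ : ℕ) < M ∧ ℓ ≠ i ∧ q i ≤ q ℓ)).card) :
    q i * ∏ ℓ ∈ univ.filter (fun ℓ : Fin N => (ℓ : ℕ) < M ∧ ℓ ≠ i), (1 - q ℓ) ≤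
      1 / mVal p := by
  have hmk : mVal p ≤ 2 * k := by
    have hkr : (k : ℝ) = (⌈mVal p⌉ : ℝ) - ⌊mVal p / 2⌋ := by exact_mod_cast hk
    linarith [Int.le_ceil (mVal p), Int.floor_le (mVal p / 2)]
  have hprod : ∏ ℓ ∈ univ.filter (fun ℓ : Fin N => (ℓ : ℕ) < M ∧ ℓ ≠ i), (1 - q ℓ) ≤
      (1 - q i) ^ k := by
    refine prod_one_sub_le_pow (fun j hj => ?_) (fun j _ => (hq j).1.le)
      (fun j _ => (hq j).2.le) (fun j hj => ?_) hcard
    · simp only [mem_filter, mem_univ, true_and] at hj ⊢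
      exact ⟨hj.1, hj.2.1⟩
    · exact (mem_filter.1 hj).2.2.2
  have hnonneg : 0 ≤ q i * (1 - q i) ^ k :=
    mul_nonneg (hq i).1.le (pow_nonneg (sub_nonneg.2 (hq i).2.le) k)
  refine (mul_le_mul_of_nonneg_left hprod (hq i).1.le).trans ?_
  rw [le_div_iff₀ (by linarith), mul_comm]
  exact (mul_le_mul_of_nonneg_right hmk hnonneg).trans
    (two_mul_mul_one_sub_pow_le_one (hq i).1.le (hq i).2.le k)
end

section
/- Let m > 2 be a real number and set k = ⌈m⌉ − ⌊m/2⌋ (an integer, which satisfies k ≥ 2). Then (1/(k+1)) · (1 − 1/(k+1))^k ≤ 1/m. -/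
/-- A consequence of Bernoulli's inequality `2 ≤ (1 + 1 / n) ^ n`. -/
theorem one_sub_one_div_succ_pow_le_half {n : ℕ} (hn : n ≠ 0) :
    (1 - 1 / ((n : ℝ) + 1)) ^ n ≤ 1 / 2 := by
  have hpos : (0 : ℝ) < n := by positivity
  have hbern := one_add_mul_le_pow (a := 1 / (n : ℝ))
    ((by norm_num : (-2 : ℝ) ≤ 0).trans (by positivity)) n
  rw [mul_one_div_cancel hpos.ne', one_add_one_eq_two] at hbern
  have hinv : 1 - 1 / ((n : ℝ) + 1) = (1 + 1 / (n : ℝ))⁻¹ := by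
    field_simp
    ring
  rw [hinv, inv_pow, ← one_div]
  exact one_div_le_one_div_of_le two_pos hbern

/-- for real `m > 2`, with `k = ⌈m⌉ - ⌊m/2⌋` (an integer, which
satisfies `k ≥ 2`), one has `(1/(k+1)) (1 - 1/(k+1))^k ≤ 1/m`. -/
theorem stmt14 (m : ℝ) (hm : 2 < m) (k : ℤ) (hk : k = ⌈m⌉ - ⌊m / 2⌋) :
    2 ≤ k ∧
    (1 / ((k : ℝ) + 1)) * (1 - 1 / ((k : ℝ) + 1)) ^ k.toNat ≤ 1 / m := by
  have hmk : m ≤ 2 * k := by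
    rw [hk]
    push_cast
    linarith [Int.le_ceil m, Int.floor_le (m / 2)]
  have hk1 : 1 < k := by
    have : (1 : ℝ) < k := by linarith
    exact_mod_cast this
  refine ⟨hk1, ?_⟩
  clear hk
  lift k to ℕ using by lia
  rw [Int.toNat_natCast, Int.cast_natCast]
  rw [Int.cast_natCast] at hmk
  calc 1 / ((k : ℝ) + 1) * (1 - 1 / ((k : ℝ) + 1)) ^ k
      ≤ 1 / ((k : ℝ) + 1) * (1 / 2) := by
        gcongr
        exact one_sub_one_div_succ_pow_le_half (by lia)
    _ = 1 / (2 * ((k : ℝ) + 1)) := by rw [one_div_mul_one_div, mul_comm]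
    _ ≤ 1 / m := one_div_le_one_div_of_le (by linarith) (by linarith)
end

section
/- Let (Ω, ℱ) be a measurable space, let k ≥ 1 be an integer, let P_0, P_1, …, P_k be probability measures on (Ω, ℱ), let B_1, …, B_k ∈ ℱ be pairwise disjoint events, and let c ∈ ℝ. If P_0(B_i) + P_i(B_iᶜ) ≥ c for every i ∈ {1,…,k}, then ∑_{i=1}^k P_i(B_iᶜ) ≥ c·k − 1, and consequently there exists i ∈ {1,…,k} with P_i(B_iᶜ) ≥ c − 1/k. -/
open MeasureTheory

/-- if `P_0, P_1, …, P_k` are probability measures, the events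
`B_1, …, B_k` are pairwise disjoint, and `P_0(B_i) + P_i(B_iᶜ) ≥ c` for every
`i`, then `∑_i P_i(B_iᶜ) ≥ c k - 1`, and consequently some `i` satisfies
`P_i(B_iᶜ) ≥ c - 1/k`. -/
theorem stmt18 {Ω : Type*} [MeasurableSpace Ω] (k : ℕ) (hk : 1 ≤ k)
    (P0 : Measure Ω) [IsProbabilityMeasure P0]
    (P : Fin k → Measure Ω) [∀ i, IsProbabilityMeasure (P i)]
    (B : Fin k → Set Ω) (hB : ∀ i, MeasurableSet (B i))
    (hdisj : Pairwise fun i j => Disjoint (B i) (B j))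
    (c : ℝ) (hc : ∀ i, c ≤ (P0 (B i)).toReal + (P i (B i)ᶜ).toReal) :
    c * k - 1 ≤ ∑ i, (P i (B i)ᶜ).toReal ∧
    ∃ i, c - 1 / k ≤ (P i (B i)ᶜ).toReal := by
  have hsum : ∑ i, (P0 (B i)).toReal ≤ 1 :=
    (measureReal_iUnion_fintype hdisj hB (μ := P0)).symm.trans_le measureReal_le_one
  have htotal : c * k - 1 ≤ ∑ i, (P i (B i)ᶜ).toReal := by
    have h := Finset.sum_le_sum fun i (_ : i ∈ Finset.univ) => hc i
    simp only [Finset.sum_const, Finset.card_univ, Fintype.card_fin, nsmul_eq_mul,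
      Finset.sum_add_distrib] at h
    linarith
  refine ⟨htotal, ?_⟩
  have : Nonempty (Fin k) := ⟨⟨0, hk⟩⟩
  have hk0 : (k : ℝ) ≠ 0 := by positivity
  obtain ⟨i, -, hi⟩ := Finset.exists_le_of_sum_le (f := fun _ : Fin k => c - 1 / k)
    (g := fun i => (P i (B i)ᶜ).toReal) Finset.univ_nonempty (by
      simp only [Finset.sum_const, Finset.card_univ, Fintype.card_fin, nsmul_eq_mul]
      rwa [mul_sub, mul_one_div_cancel hk0, mul_comm])
  exact ⟨i, hi⟩
end
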